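/- Let z ∈ ℤ, let k ∈ ℕ, and let α, β be real numbers with 0 < β ≤ α ≤ 1. Let I = [z − α, z + 2k + 1 + β] ⊆ ℝ. Then the set of integers in the interior of I is exactly {z, z+1, …, z+2k+1}, and the Pikhurko constant γ(ℤ, I) equals (k + α)/(2k + 1 + α + β); moreover this maximum is attained at the point P = z + k. -/

import Mathlib

open Pointwise

/-- The coefficient of asymmetry `γ(P ∈ K) = sSup {t ≥ 0 : P + t • (K - K) ⊆ K}`. -/
noncomputable def asym {E : Type*} [AddCommGroup E] [Module ℝ E] (K : Set E) (P : E) : ℝ :=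
  sSup {t : ℝ | 0 ≤ t ∧ ∀ x ∈ K - K, P + t • x ∈ K}

/-- The Pikhurko constant `γ(ℤ, K)` of a subset of `ℝ`: the supremum of the coefficients of
asymmetry over integer points of the interior of `K`. -/
noncomputable def pik (K : Set ℝ) : ℝ :=
  sSup (asym K '' ({x : ℝ | ∃ z : ℤ, x = (z : ℝ)} ∩ interior K))

/-- The coefficient of asymmetry of a point of a nondegenerate compact interval. -/
theorem asym_Icc {a b P : ℝ} (hab : a < b) (hP : P ∈ Set.Icc a b) :
    asym (Set.Icc a b) P = min (P - a) (b - P) / (b - a) := by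
  have hd : 0 < b - a := sub_pos.2 hab
  have hset : {t : ℝ | 0 ≤ t ∧ ∀ x ∈ Set.Icc a b - Set.Icc a b, P + t • x ∈ Set.Icc a b}
      = Set.Icc 0 (min (P - a) (b - P) / (b - a)) := by
    ext t
    simp only [Set.mem_ofPred_eq, Set.mem_Icc, smul_eq_mul, le_div_iff₀ hd, le_min_iff]
    refine and_congr_right fun ht => ⟨fun h => ?_, fun h x hx => ?_⟩
    · have h₁ := h (b - a) (Set.sub_mem_sub (Set.right_mem_Icc.2 hab.le)
        (Set.left_mem_Icc.2 hab.le))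
      have h₂ := h (a - b) (Set.sub_mem_sub (Set.left_mem_Icc.2 hab.le)
        (Set.right_mem_Icc.2 hab.le))
      constructor <;> linarith
    · obtain ⟨u, ⟨hu₁, hu₂⟩, v, ⟨hv₁, hv₂⟩, rfl⟩ := hx
      have h₁ : t * (u - v) ≤ t * (b - a) := mul_le_mul_of_nonneg_left (by linarith) ht
      have h₂ : t * (v - u) ≤ t * (b - a) := mul_le_mul_of_nonneg_left (by linarith) ht
      constructor <;> dsimp only <;> linarith
  rw [asym, hset, csSup_Icc]
  exact div_nonneg (le_min (sub_nonneg.2 hP.1) (sub_nonneg.2 hP.2)) hd.le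

/-- For `z ∈ ℤ`, `k ∈ ℕ`, `0 < β ≤ α ≤ 1` and `I = [z - α, z + 2k + 1 + β]`:
the integers interior to `I` are exactly `{z, …, z + 2k + 1}`, and
`γ(ℤ, I) = (k + α)/(2k + 1 + α + β)`, attained at `P = z + k`. -/
theorem stmt_3 (z : ℤ) (k : ℕ) (α β : ℝ) (hβ : 0 < β) (hβα : β ≤ α) (hα : α ≤ 1) :
    ({x : ℝ | ∃ n : ℤ, x = (n : ℝ)} ∩
        interior (Set.Icc ((z : ℝ) - α) ((z : ℝ) + 2 * k + 1 + β))
      = {x : ℝ | ∃ n : ℤ, z ≤ n ∧ n ≤ z + 2 * (k : ℤ) + 1 ∧ x = (n : ℝ)}) ∧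
    pik (Set.Icc ((z : ℝ) - α) ((z : ℝ) + 2 * k + 1 + β)) = (k + α) / (2 * k + 1 + α + β) ∧
    asym (Set.Icc ((z : ℝ) - α) ((z : ℝ) + 2 * k + 1 + β)) ((z : ℝ) + k)
      = (k + α) / (2 * k + 1 + α + β) := by
  have hk : (0 : ℝ) ≤ k := k.cast_nonneg
  have hlen : (0 : ℝ) < 2 * k + 1 + α + β := by linarith
  have hint : {x : ℝ | ∃ n : ℤ, x = (n : ℝ)} ∩
        interior (Set.Icc ((z : ℝ) - α) ((z : ℝ) + 2 * k + 1 + β))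
      = {x : ℝ | ∃ n : ℤ, z ≤ n ∧ n ≤ z + 2 * (k : ℤ) + 1 ∧ x = (n : ℝ)} := by
    rw [interior_Icc]
    ext x
    constructor
    · rintro ⟨⟨n, rfl⟩, h₁, h₂⟩
      refine ⟨n, ?_, ?_, rfl⟩
      · have h : (z : ℝ) < ((n + 1 : ℤ) : ℝ) := by push_cast; linarith
        exact Int.lt_add_one_iff.1 (Int.cast_lt.1 h)
      · have h : (n : ℝ) < ((z + 2 * (k : ℤ) + 1 + 1 : ℤ) : ℝ) := by push_cast; linarith
        exact Int.lt_add_one_iff.1 (Int.cast_lt.1 h)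
    · rintro ⟨n, h₁, h₂, rfl⟩
      have h₁' : (z : ℝ) ≤ n := by exact_mod_cast h₁
      have h₂' : (n : ℝ) ≤ z + 2 * k + 1 := by exact_mod_cast h₂
      exact ⟨⟨n, rfl⟩, by linarith, by linarith⟩
  have hasym : asym (Set.Icc ((z : ℝ) - α) ((z : ℝ) + 2 * k + 1 + β)) ((z : ℝ) + k)
      = (k + α) / (2 * k + 1 + α + β) := by
    rw [asym_Icc (by linarith) ⟨by linarith, by linarith⟩, min_eq_left (by linarith)]
    congr 1 <;> ring
  refine ⟨hint, IsGreatest.csSup_eq ⟨⟨z + k, ?_, hasym⟩, ?_⟩, hasym⟩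
  · rw [hint]
    exact ⟨z + k, by omega, by omega, by push_cast; rfl⟩
  · rw [hint]
    rintro _ ⟨_, ⟨n, h₁, h₂, rfl⟩, rfl⟩
    have h₁' : (z : ℝ) ≤ n := by exact_mod_cast h₁
    have h₂' : (n : ℝ) ≤ z + 2 * k + 1 := by exact_mod_cast h₂
    rw [asym_Icc (by linarith) ⟨by linarith, by linarith⟩,
      show (z : ℝ) + 2 * k + 1 + β - (z - α) = 2 * k + 1 + α + β by ring]
    refine div_le_div_of_nonneg_right (min_le_iff.2 ?_) hlen.le
    rcases le_or_gt n (z + k) with h | h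
    · have h' : (n : ℝ) ≤ z + k := by exact_mod_cast h
      left; linarith
    · have h' : (z : ℝ) + k + 1 ≤ n := by exact_mod_cast h
      right; linarith
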